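/- Let $F$ be a field elementarily equivalent to some finite or PAC field that contains no separably closed subfield, and let $v$ be a nontrivial valuation on $F$. Then the residue field $Fv$ is separably closed; in particular, $Fv$ does not embed into any field elementarily equivalent to $F$. -/

import Mathlib

open FirstOrder

universe u

/-- Two rings are elementarily equivalent in the language of rings. -/
def RingElemEquiv (F₁ : Type*) (F₂ : Type*) [Ring F₁] [Ring F₂] : Prop :=
  letI := Ring.compatibleRingOfRing F₁
  letI := Ring.compatibleRingOfRing F₂
  F₁ ≅[Language.ring] F₂

/-- A field is pseudo-algebraically closed: every geometrically integral affine variety over it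
(cut out by an ideal which stays prime over the algebraic closure) has a rational point. -/
def IsPAC (E : Type*) [Field E] : Prop :=
  ∀ (n : ℕ) (I : Ideal (MvPolynomial (Fin n) E)),
    (Ideal.map (MvPolynomial.map (algebraMap E (AlgebraicClosure E))) I).IsPrime →
    ∃ x : Fin n → E, ∀ p ∈ I, MvPolynomial.eval x p = 0

open Polynomial

open Language FirstOrder.Ring in
/-- Elementary equivalence transfers statements of the form `∀ a, d(a) ≠ 0 → ∃ b, q(a, b) = 0`. -/
theorem RingElemEquiv.forall_exists {E F : Type u} {α β : Type*} [CommRing E] [CommRing F]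
    [Finite α] [Finite β] (h : RingElemEquiv E F) (d : FreeCommRing α) (q : FreeCommRing (α ⊕ β))
    (hE : ∀ a : α → E, FreeCommRing.lift a d ≠ 0 →
      ∃ b : β → E, FreeCommRing.lift (Sum.elim a b) q = 0)
    (a : α → F) (ha : FreeCommRing.lift a d ≠ 0) :
    ∃ b : β → F, FreeCommRing.lift (Sum.elim a b) q = 0 := by
  let _ := compatibleRingOfRing E
  let _ := compatibleRingOfRing F
  replace h : E ≅[Language.ring] F := h
  let ψ : Language.ring.Formula α :=
    Term.equal (termOfFreeCommRing d) 0 ⊔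
      (Term.equal (termOfFreeCommRing q) 0 : Language.ring.Formula (α ⊕ β)).iExs β
  let φ : Language.ring.Sentence := (ψ.relabel (Sum.inr : α → Empty ⊕ α)).iAlls α
  have key : ∀ (K : Type u) [CommRing K] [CompatibleRing K], K ⊨ φ ↔ ∀ a : α → K,
      FreeCommRing.lift a d ≠ 0 → ∃ b : β → K, FreeCommRing.lift (Sum.elim a b) q = 0 := by
    intro K _ _
    simp [Sentence.Realize, φ, ψ, Formula.realize_relabel, Function.comp_def, or_iff_not_imp_left]
  exact (key F).1 ((elementarilyEquivalent_iff.1 h φ).1 ((key E).2 hE)) a ha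

theorem RingElemEquiv.symm {E F : Type*} [Ring E] [Ring F] (h : RingElemEquiv E F) :
    RingElemEquiv F E :=
  let _ := Ring.compatibleRingOfRing E
  let _ := Ring.compatibleRingOfRing F
  Language.ElementarilyEquivalent.symm (L := Language.ring) (M := E) (N := F) h

theorem RingElemEquiv.trans {E F K : Type*} [Ring E] [Ring F] [Ring K] (h : RingElemEquiv E F)
    (h' : RingElemEquiv F K) : RingElemEquiv E K :=
  let _ := Ring.compatibleRingOfRing E
  let _ := Ring.compatibleRingOfRing F
  let _ := Ring.compatibleRingOfRing K
  Language.ElementarilyEquivalent.trans (L := Language.ring) (M := E) (N := F) (P := K) h h'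

theorem RingElemEquiv.finite {E F : Type*} [Ring E] [Ring F] (h : RingElemEquiv E F)
    [hF : Finite F] : Finite E := by
  let _ := Ring.compatibleRingOfRing E
  let _ := Ring.compatibleRingOfRing F
  rw [← not_infinite_iff_finite] at hF ⊢
  exact fun hE => hF ((Language.ElementarilyEquivalent.infinite_iff h).1 hE)

theorem RingElemEquiv.exists_aeval_int {E F : Type u} [CommRing E] [CommRing F]
    [Nontrivial E] [Nontrivial F]
    (h : RingElemEquiv E F) (P : ℤ[X]) (hE : ∃ x : E, aeval x P = 0) :
    ∃ x : F, aeval x P = 0 := by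
  let q : FreeCommRing (Empty ⊕ Unit) := aeval (FreeCommRing.of (Sum.inr ())) P
  have key : ∀ {K : Type u} [CommRing K] (a : Empty ⊕ Unit → K),
      FreeCommRing.lift a q = aeval (a (Sum.inr ())) P := by
    intro K _ a
    simp only [q, aeval_def, hom_eval₂, FreeCommRing.lift_of]
    congr 1
    exact RingHom.ext_int _ _
  obtain ⟨x, hx⟩ := hE
  obtain ⟨b, hb⟩ := h.forall_exists (1 : FreeCommRing Empty) q
    (fun a _ => ⟨fun _ => x, (key _).trans hx⟩) Empty.elim (by simp)
  exact ⟨b (), (key _).symm.trans hb⟩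

/-- The monic polynomial `X ^ n + a_{n-1} X ^ (n-1) + ⋯ + a_0` with prescribed coefficients. -/
noncomputable def monicOfCoeffs {A : Type*} [CommRing A] {n : ℕ} (a : Fin n → A) : A[X] :=
  X ^ n + ∑ i : Fin n, C (a i) * X ^ (i : ℕ)

theorem monicOfCoeffs_coeff {A : Type*} [CommRing A] {f : A[X]} (hf : f.Monic) :
    monicOfCoeffs (fun i : Fin f.natDegree => f.coeff i) = f := by
  conv_rhs => rw [hf.as_sum]
  rw [monicOfCoeffs, Finset.sum_range]

theorem monicOfCoeffs_monic_and_natDegree {A : Type*} [CommRing A] [Nontrivial A] {n : ℕ}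
    (a : Fin n → A) :
    (monicOfCoeffs a).Monic ∧ (monicOfCoeffs a).natDegree = n := by
  have h : (∑ i : Fin n, C (a i) * X ^ (i : ℕ)).degree < (n : WithBot ℕ) := degree_sum_fin_lt a
  refine ⟨monic_X_pow_add h, ?_⟩
  rw [monicOfCoeffs, natDegree_eq_of_degree_eq_some]
  rw [degree_add_eq_left_of_degree_lt (by simpa using h), degree_X_pow]

theorem map_monicOfCoeffs {A B : Type*} [CommRing A] [CommRing B] (φ : A →+* B) {n : ℕ}
    (a : Fin n → A) : (monicOfCoeffs a).map φ = monicOfCoeffs (fun i => φ (a i)) := by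
  simp [monicOfCoeffs, Polynomial.map_sum]

/-- The resultant of a polynomial and its derivative, both regarded as polynomials of degree at
most `n`. -/
noncomputable def derivResultant {A : Type*} [CommRing A] (f : A[X]) (n : ℕ) : A :=
  resultant f (derivative f) n n

theorem map_derivResultant {A B : Type*} [CommRing A] [CommRing B] (φ : A →+* B) (f : A[X])
    (n : ℕ) : derivResultant (f.map φ) n = φ (derivResultant f n) := by
  rw [derivResultant, derivative_map, resultant_map_map, derivResultant]

theorem derivResultant_ne_zero_iff {K : Type*} [Field K] {f : K[X]} (hf : f.Monic) :
    derivResultant f f.natDegree ≠ 0 ↔ f.Separable := by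
  have h : (derivative f).natDegree ≤ f.natDegree :=
    (natDegree_derivative_le f).trans (Nat.sub_le _ _)
  rw [derivResultant, Separable, ← isUnit_resultant_iff_isCoprime hf, isUnit_iff_ne_zero]
  obtain ⟨k, hk⟩ := Nat.exists_eq_add_of_le h
  nth_rw 2 [hk]
  rw [resultant_add_right_deg _ _ _ _ _ le_rfl, coeff_natDegree, hf.leadingCoeff, one_pow, one_mul]

/-- The property of a field that, for every separable monic `f` and every `c ≠ 0`, the equation
`f(x) f(y⁻¹) = c`, cleared of denominators, has a solution. -/
def HasSymmSolutions (K : Type*) [Field K] : Prop :=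
  ∀ f : K[X], f.Monic → 0 < f.natDegree → f.Separable → ∀ c : K, c ≠ 0 →
    ∃ x y, f.eval x * f.reverse.eval y = c * y ^ f.natDegree

theorem eval_reverse_eq_sum {A : Type*} [CommRing A] {f : A[X]} (hf : f.Monic) (y : A) :
    f.reverse.eval y = 1 + ∑ i : Fin f.natDegree, f.coeff i * y ^ (f.natDegree - i) := by
  rw [eval_eq_sum_range' (n := f.natDegree + 1) (Nat.lt_succ_of_le f.reverse_natDegree_le),
    ← Finset.sum_range_reflect, Finset.sum_range_succ, add_comm, ← Fin.sum_univ_eq_sum_range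
      (fun j => f.reverse.coeff (f.natDegree + 1 - 1 - j) * y ^ (f.natDegree + 1 - 1 - j))]
  congr 1
  · simp [hf]
  · refine Finset.sum_congr rfl fun i _ => ?_
    rw [Nat.add_sub_cancel, coeff_reverse, revAt_le (Nat.sub_le _ _), Nat.sub_sub_self i.2.le]

theorem RingElemEquiv.hasSymmSolutions {E F : Type u} [Field E] [Field F]
    (h : RingElemEquiv E F) (hE : HasSymmSolutions E) : HasSymmSolutions F := by
  intro f hf hn hs c hc
  set n := f.natDegree with hnf
  let p : (FreeCommRing (Option (Fin n)))[X] := monicOfCoeffs fun i => FreeCommRing.of (some i)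
  let r : FreeCommRing (Option (Fin n) ⊕ Fin 2) :=
    ((FreeCommRing.of (.inr 0)) ^ n +
      ∑ i : Fin n, FreeCommRing.of (.inl (some i)) * FreeCommRing.of (.inr 0) ^ (i : ℕ)) *
    (1 + ∑ i : Fin n, FreeCommRing.of (.inl (some i)) * FreeCommRing.of (.inr 1) ^ (n - i)) -
      FreeCommRing.of (.inl none) * FreeCommRing.of (.inr 1) ^ n
  have hp {K : Type u} [Field K] (a : Option (Fin n) → K) :
      p.map (FreeCommRing.lift a) = monicOfCoeffs fun i => a (some i) := by
    simp [p, map_monicOfCoeffs]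
  have hd {K : Type u} [Field K] (a : Option (Fin n) → K) :
      FreeCommRing.lift a (FreeCommRing.of none * derivResultant p n) =
        a none * derivResultant (monicOfCoeffs fun i => a (some i)) n := by
    rw [map_mul, ← map_derivResultant, hp, FreeCommRing.lift_of]
  have hr {K : Type u} [Field K] (g : K[X]) (hg : g.Monic) (hgn : g.natDegree = n)
      (a : Option (Fin n) → K) (ha : ∀ i, a (some i) = g.coeff i) (b : Fin 2 → K) :
      FreeCommRing.lift (Sum.elim a b) r =
        g.eval (b 0) * g.reverse.eval (b 1) - a none * (b 1) ^ n := by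
    have e : g.eval (b 0) = b 0 ^ n + ∑ i : Fin n, g.coeff i * b 0 ^ (i : ℕ) := by
      conv_lhs => rw [hg.as_sum, hgn, Finset.sum_range]
      simp [eval_finsetSum]
    rw [e, eval_reverse_eq_sum hg, hgn]
    simp [r, ha]
  obtain ⟨b, hb⟩ := h.forall_exists (FreeCommRing.of none * derivResultant p n) r (fun a ha => by
      rw [hd] at ha
      obtain ⟨hm, hd⟩ := monicOfCoeffs_monic_and_natDegree fun i => a (some i)
      obtain ⟨x, y, hxy⟩ := hE _ hm (by rwa [hd])
        ((derivResultant_ne_zero_iff hm).1 (by rw [hd]; exact right_ne_zero_of_mul ha))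
        _ (left_ne_zero_of_mul ha)
      refine ⟨![x, y], ?_⟩
      rw [hr _ hm hd]
      · rw [hd] at hxy
        simpa [sub_eq_zero] using hxy
      · simp [monicOfCoeffs, coeff_X_pow, Fin.val_inj,  (Fin.is_lt _).ne])
    (fun o => o.elim c fun i => f.coeff i) (by
      rw [hd]
      refine mul_ne_zero hc ?_
      have e : monicOfCoeffs (fun i : Fin n => f.coeff i) = f := monicOfCoeffs_coeff hf
      change derivResultant (monicOfCoeffs fun i : Fin n => f.coeff i) n ≠ 0
      rw [e]
      exact (derivResultant_ne_zero_iff hf).2 hs)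
  rw [hr f hf rfl _ (by simp), sub_eq_zero] at hb
  exact ⟨b 0, b 1, hb⟩

/-- The polynomial `f(X₁) f*(X₀) - c X₀ ^ deg f`, where `f*` is the reverse of `f`. -/
noncomputable def symmPoly {K : Type*} [CommRing K] (f : K[X]) (c : K) : MvPolynomial (Fin 2) K :=
  aeval (MvPolynomial.X 1) f * aeval (MvPolynomial.X 0) f.reverse -
    MvPolynomial.C c * MvPolynomial.X 0 ^ f.natDegree

theorem finSuccEquiv_symmPoly {K : Type*} [CommRing K] (f : K[X]) (c : K) :
    MvPolynomial.finSuccEquiv K 1 (symmPoly f c) =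
      C (aeval (MvPolynomial.X 0) f) * f.reverse.map MvPolynomial.C -
        C (MvPolynomial.C c) * X ^ f.natDegree := by
  have h1 : MvPolynomial.finSuccEquiv K 1 (MvPolynomial.X 1) = C (MvPolynomial.X 0) :=
    MvPolynomial.finSuccEquiv_X_succ (j := 0)
  have hC : MvPolynomial.finSuccEquiv K 1 (MvPolynomial.C c) = C (MvPolynomial.C c) := by
    simp [MvPolynomial.finSuccEquiv_apply]
  have e1 : aeval (C (MvPolynomial.X 0) : (MvPolynomial (Fin 1) K)[X]) f =
      C (aeval (MvPolynomial.X 0) f) :=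
    aeval_algebraMap_apply (A := MvPolynomial (Fin 1) K) _ _ f
  have e2 : aeval (X : (MvPolynomial (Fin 1) K)[X]) f.reverse = f.reverse.map MvPolynomial.C := by
    rw [aeval_def, Polynomial.map]
    rfl
  rw [symmPoly, map_sub, map_mul, map_mul, ← aeval_algHom_apply, ← aeval_algHom_apply, map_pow,
    h1, hC, MvPolynomial.finSuccEquiv_X_zero, e1, e2]

theorem eval_aeval_X {σ K : Type*} [CommRing K] (x : σ → K) (i : σ) (p : K[X]) :
    MvPolynomial.eval x (aeval (MvPolynomial.X i) p) = p.eval (x i) := by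
  rw [← MvPolynomial.aeval_eq_eval, ← aeval_algHom_apply]
  simp

/-- A polynomial with a simple root at `α` is not in the square of the ideal of `α`. -/
theorem aeval_X_notMem_sq {K : Type*} [Field K] {f : K[X]} {α : K}
    (h : (derivative f).eval α ≠ 0) :
    aeval (MvPolynomial.X 0 : MvPolynomial (Fin 1) K) f ∉
      RingHom.ker (MvPolynomial.eval fun _ : Fin 1 => α) ^ 2 := by
  intro hf
  have key : ∀ q ∈ RingHom.ker (MvPolynomial.eval fun _ : Fin 1 => α) ^ 2,
      MvPolynomial.eval (fun _ => α) (MvPolynomial.pderiv 0 q) = 0 := by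
    intro q hq
    rw [pow_two] at hq
    induction hq using Submodule.mul_induction_on' with
    | mem_mul_mem a ha b hb =>
      simp [Derivation.leibniz, RingHom.mem_ker.1 ha, RingHom.mem_ker.1 hb]
    | add x _ y _ hx hy => rw [map_add, map_add, hx, hy, add_zero]
  apply h
  have := key _ hf
  rw [Derivation.map_aeval] at this
  simpa [eval_aeval_X] using this

theorem irreducible_symmPoly {K : Type*} [Field K] [IsAlgClosed K] {f : K[X]} (hf : f.Monic)
    (hn : 0 < f.natDegree) (hs : f.Separable) {c : K} (hc : c ≠ 0) :
    Irreducible (symmPoly f c) := by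
  rw [← MulEquiv.irreducible_iff (MvPolynomial.finSuccEquiv K 1), finSuccEquiv_symmPoly]
  obtain ⟨α, hα⟩ := IsAlgClosed.exists_root f (natDegree_pos_iff_degree_pos.1 hn).ne'
  set F : MvPolynomial (Fin 1) K := aeval (MvPolynomial.X 0) f with hF
  set P := RingHom.ker (MvPolynomial.eval fun _ : Fin 1 => α) with hP
  set H := C F * f.reverse.map MvPolynomial.C - C (MvPolynomial.C c) * X ^ f.natDegree with hH
  have hFP : F ∈ P := by
    rw [hP, RingHom.mem_ker, hF, eval_aeval_X]
    exact hα
  have hcoeff (i : ℕ) : H.coeff i = F * MvPolynomial.C (f.reverse.coeff i) -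
      if i = f.natDegree then MvPolynomial.C c else 0 := by
    simp [hH, coeff_X_pow]
  have hcn : H.coeff f.natDegree ∉ P := by
    rw [hcoeff, if_pos rfl]
    intro h
    have := (Submodule.sub_mem_iff_right P (P.mul_mem_right _ hFP)).1 h
    exact hc (by simpa [hP, RingHom.mem_ker] using this)
  have hle : H.natDegree ≤ f.natDegree := by
    rw [natDegree_le_iff_coeff_eq_zero]
    intro i hi
    rw [hcoeff, if_neg hi.ne', coeff_eq_zero_of_natDegree_lt (f.reverse_natDegree_le.trans_lt hi)]
    simp
  have hdeg : H.natDegree = f.natDegree :=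
    hle.antisymm (le_natDegree_of_ne_zero fun h => hcn (h ▸ P.zero_mem))
  have h0 : H.coeff 0 = F := by
    simp [hcoeff, hn.ne, hf]
  refine irreducible_of_eisenstein_criterion (RingHom.ker_isPrime _ : P.IsPrime) ?_ ?_ ?_ ?_ ?_
  · rwa [leadingCoeff, hdeg]
  · intro i hi
    have hi' : i ≠ f.natDegree := fun h => by
      rw [h, ← hdeg] at hi
      exact hi.not_ge degree_le_natDegree
    rw [hcoeff, if_neg hi', sub_zero]
    exact P.mul_mem_right _ hFP
  · rw [← natDegree_pos_iff_degree_pos, hdeg]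
    exact hn
  · rw [h0]
    exact aeval_X_notMem_sq (by simpa using hs.aeval_derivative_ne_zero (x := α) (by simpa using hα))
  · intro r hr
    rw [C_dvd_iff_dvd_coeff] at hr
    have hrF := h0 ▸ hr 0
    have hrc := hr f.natDegree
    rw [hcoeff, if_pos rfl, dvd_sub_right (hrF.mul_right _)] at hrc
    exact isUnit_of_dvd_unit hrc ((isUnit_iff_ne_zero.2 hc).map MvPolynomial.C)

theorem IsPAC.hasSymmSolutions {E : Type*} [Field E] (h : IsPAC E) : HasSymmSolutions E := by
  intro f hf hn hs c hc
  let φ := algebraMap E (AlgebraicClosure E)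
  have hmap : MvPolynomial.map φ (symmPoly f c) = symmPoly (f.map φ) (φ c) := by
    have e (i : Fin 2) (p : E[X]) : MvPolynomial.map φ (aeval (MvPolynomial.X i) p) =
        aeval (MvPolynomial.X i) (p.map φ) := by
      rw [aeval_def, aeval_def, hom_eval₂, eval₂_map, MvPolynomial.map_X]
      congr 1
      ext x
      simp [MvPolynomial.algebraMap_eq]
    simp [symmPoly, e, reverse, reflect_map]
  obtain ⟨x, hx⟩ := h 2 (Ideal.span {symmPoly f c}) (by
    rw [Ideal.map_span, Set.image_singleton, hmap]
    have hirr := irreducible_symmPoly (hf.map φ) (by simpa using hn) hs.map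
      ((map_ne_zero φ).2 hc)
    exact (Ideal.span_singleton_prime hirr.ne_zero).2 hirr.prime)
  refine ⟨x 1, x 0, ?_⟩
  simpa [symmPoly, eval_aeval_X, sub_eq_zero] using
    hx _ (Ideal.mem_span_singleton_self _)

theorem HasSymmSolutions.isSepClosed_residueField {F : Type*} [Field F] (h : HasSymmSolutions F)
    (O : ValuationSubring F) (hO : O ≠ ⊤) : IsSepClosed (IsLocalRing.ResidueField O) := by
  refine IsSepClosed.of_exists_root _ fun p hp hirr hs => ?_
  obtain ⟨f, rfl, hfn, hf⟩ := lifts_and_natDegree_eq_and_monic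
    ((mem_lifts _).2 (map_surjective _ IsLocalRing.residue_surjective p)) hp
  have hinj : Function.Injective (algebraMap O F) := Subtype.val_injective
  have hn : 0 < f.natDegree := hfn ▸ hirr.natDegree_pos
  have hsF : (f.map (algebraMap O F)).Separable := by
    rw [← derivResultant_ne_zero_iff (hf.map _), map_derivResultant, map_ne_zero_iff _ hinj,
      hf.natDegree_map]
    rw [← derivResultant_ne_zero_iff (hf.map _), map_derivResultant, hf.natDegree_map] at hs
    exact fun h0 => hs (by rw [h0, map_zero])
  obtain ⟨a, ha⟩ : ∃ a, a ∉ O := by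
    by_contra! H
    exact hO (top_le_iff.1 fun x _ => H x)
  have ha' : 1 < O.valuation a := by
    rwa [← not_le, O.valuation_le_one_iff]
  have ha0 : a ≠ 0 := fun h => ha (h ▸ O.zero_mem)
  obtain ⟨x, y, hxy⟩ := h _ (hf.map _) (by rwa [hf.natDegree_map]) hsF a⁻¹ (inv_ne_zero ha0)
  rw [hf.natDegree_map] at hxy
  obtain ⟨z, hz⟩ : ∃ z, O.valuation ((f.map (algebraMap O F)).eval z) < 1 := by
    by_contra! H
    rcases eq_or_ne y 0 with rfl | hy
    · have h0 : (f.map (algebraMap O F)).eval x = 0 := by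
        simpa [hn.ne', ← coeff_zero_eq_eval_zero, (hf.map (algebraMap O F)).leadingCoeff] using hxy
      simpa [h0] using H x
    · have := invertibleOfNonzero (inv_ne_zero hy)
      have hrev := eval₂_reverse_mul_pow (RingHom.id F) y⁻¹ (f.map (algebraMap O F))
      rw [invOf_eq_inv, inv_inv, hf.natDegree_map] at hrev
      change eval y _ * _ = eval y⁻¹ _ at hrev
      have hprod : (f.map (algebraMap O F)).eval x * (f.map (algebraMap O F)).eval y⁻¹ = a⁻¹ := by
        rw [← hrev, ← mul_assoc, hxy, mul_assoc, ← mul_pow, mul_inv_cancel₀ hy, one_pow, mul_one]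
      have h1 := one_le_mul (H x) (H y⁻¹)
      rw [← map_mul, hprod, map_inv₀, one_le_inv₀ (zero_lt_one.trans ha')] at h1
      exact h1.not_gt ha'
  set t : O := ⟨_, (O.valuation_le_one_iff _).1 hz.le⟩ with ht
  have htm : t ∈ IsLocalRing.maximalIdeal O := (O.valuation_lt_one_iff t).2 hz
  have hzint : IsIntegral O z := by
    refine ⟨f - C t, hf.sub_of_left ?_, ?_⟩
    · exact degree_C_le.trans_lt (natDegree_pos_iff_degree_pos.1 hn)
    · rw [eval₂_sub, eval₂_C, eval₂_eq_eval_map]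
      exact sub_self _
  obtain ⟨w, rfl⟩ := IsIntegrallyClosed.isIntegral_iff.1 hzint
  refine ⟨IsLocalRing.residue O w, ?_⟩
  have hw : f.eval w = t := hinj (by rw [← eval_map_apply]; rfl)
  rw [eval_map_apply, hw]
  exact (IsLocalRing.residue_eq_zero_iff t).2 htm

theorem ValuationSubring.eq_top_of_finite {F : Type*} [Field F] [Finite F]
    (O : ValuationSubring F) : O = ⊤ := by
  refine top_le_iff.1 fun x _ => ?_
  obtain ⟨w, rfl⟩ := IsIntegrallyClosed.isIntegral_iff.1
    ((Algebra.IsIntegral.isIntegral (R := O) x))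
  exact w.2

theorem aeval_int_of_map_eq {K L : Type*} [Field K] [Field L] [Algebra K L] {P : ℤ[X]} {p : K[X]}
    {c : K} (h : P.map (Int.castRingHom K) = C c * p) (x : L) :
    aeval x P = algebraMap K L c * aeval x p := by
  rw [← aeval_C x c, ← map_mul, ← h, aeval_def, aeval_def, eval₂_map]
  congr 1
  exact RingHom.ext_int _ _

theorem exists_isSepClosed_subfield_of_perfectField {K k E : Type*} [Field K] [Field k] [Field E]
    [PerfectField K] [IsSepClosed k] [Algebra K k] [Algebra K E]
    (hK : ∀ p : K[X], ∃ P : ℤ[X], ∃ c : K, c ≠ 0 ∧ P.map (Int.castRingHom K) = C c * p)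
    (hroot : ∀ P : ℤ[X], (∃ x : k, aeval x P = 0) → ∃ x : E, aeval x P = 0) :
    ∃ S : Subfield E, IsSepClosed S := by
  refine ⟨(algebraicClosure K E).toSubfield, ?_⟩
  have hclosed : IsAlgClosure K (algebraicClosure K E) := .of_exists_root fun p _ hirr => by
    obtain ⟨P, c, hc, hP⟩ := hK p
    obtain ⟨x, hx⟩ := IsSepClosed.exists_aeval_eq_zero k p (degree_pos_of_irreducible hirr).ne'
      (PerfectField.separable_of_irreducible hirr)
    obtain ⟨y, hy⟩ := hroot P ⟨x, by rw [aeval_int_of_map_eq hP, hx, mul_zero]⟩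
    rw [aeval_int_of_map_eq hP] at hy
    have hy0 : aeval y p = 0 := (mul_eq_zero.1 hy).resolve_left (by simpa using hc)
    refine ⟨⟨y, mem_algebraicClosure_iff.2 ⟨p, hirr.ne_zero, hy0⟩⟩,
      (algebraMap (algebraicClosure K E) E).injective ?_⟩
    rwa [← aeval_algebraMap_apply, map_zero]
  have : IsAlgClosed (algebraicClosure K E) := hclosed.isAlgClosed
  exact inferInstanceAs (IsSepClosed (algebraicClosure K E))

theorem exists_isSepClosed_subfield {k E : Type*} [Field k] [Field E] [IsSepClosed k]
    (hchar : ∀ n : ℕ, (n : k) = 0 ↔ (n : E) = 0)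
    (hroot : ∀ P : ℤ[X], (∃ x : k, aeval x P = 0) → ∃ x : E, aeval x P = 0) :
    ∃ S : Subfield E, IsSepClosed S := by
  obtain ⟨p, hpE⟩ := CharP.exists E
  have hpk : CharP k p := ⟨fun n => (hchar n).trans (CharP.cast_eq_zero_iff E p n)⟩
  rcases CharP.char_is_prime_or_zero E p with hp | rfl
  · have : Fact p.Prime := ⟨hp⟩
    let _ : Algebra (ZMod p) E := ZMod.algebra E p
    let _ : Algebra (ZMod p) k := ZMod.algebra k p
    refine exists_isSepClosed_subfield_of_perfectField (K := ZMod p) (k := k) (fun q => ?_) hroot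
    obtain ⟨P, hP⟩ := map_surjective (Int.castRingHom (ZMod p)) ZMod.intCast_surjective q
    exact ⟨P, 1, one_ne_zero, by simpa using hP⟩
  · have : CharZero E := CharP.charP_to_charZero E
    have : CharZero k := CharP.charP_to_charZero k
    refine exists_isSepClosed_subfield_of_perfectField (K := ℚ) (k := k) (fun q => ?_) hroot
    obtain ⟨b, hb, h⟩ := IsLocalization.integerNormalization_spec (nonZeroDivisors ℤ) q
    refine ⟨_, b, Int.cast_ne_zero.2 (nonZeroDivisors.ne_zero hb), h.trans ?_⟩
    rw [zsmul_eq_mul]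
    simp

/-- If a separably closed field embeds into a field elementarily equivalent to `E`, then `E` has a
separably closed subfield. -/
theorem RingElemEquiv.exists_isSepClosed_subfield {k : Type*} {E F : Type u} [Field k] [Field E]
    [Field F] [IsSepClosed k] (h : RingElemEquiv F E) (ψ : k →+* F) :
    ∃ S : Subfield E, IsSepClosed S := by
  have hconst {A : Type u} [Field A] (n : ℕ) :
      (∃ x : A, aeval x (C (n : ℤ)) = 0) ↔ (n : A) = 0 := by
    simp
  refine _root_.exists_isSepClosed_subfield (k := k) (fun n => ?_) (fun P ⟨x, hx⟩ =>
    h.exists_aeval_int P ⟨ψ x, ?_⟩)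
  · rw [← map_eq_zero ψ, map_natCast, ← hconst, ← hconst]
    exact ⟨h.exists_aeval_int _, h.symm.exists_aeval_int _⟩
  · exact (aeval_algHom_apply ψ.toIntAlgHom x P).trans ((congrArg ψ hx).trans (map_zero ψ))

/-- If `F` is elementarily equivalent to a finite or PAC field containing no separably closed
subfield, then the residue field of any nontrivial valuation on `F` is separably closed; in
particular it embeds into no field elementarily equivalent to `F`. -/
theorem stmt_16 (F : Type u) [Field F]
    (h : ∃ (E : Type u) (iE : Field E),
      letI := iE
      (Finite E ∨ IsPAC E) ∧ (∀ S : Subfield E, ¬ IsSepClosed ↥S) ∧ RingElemEquiv F E)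
    (O : ValuationSubring F) (hO : O ≠ ⊤) :
    IsSepClosed (IsLocalRing.ResidueField ↥O) ∧
      ∀ (F₂ : Type u) [Field F₂], RingElemEquiv F₂ F →
        IsEmpty (IsLocalRing.ResidueField ↥O →+* F₂) := by
  obtain ⟨E, iE, hE, hsub, hFE⟩ := h
  rcases hE with hfin | hPAC
  · have := hFE.finite
    exact absurd O.eq_top_of_finite hO
  have hk := (hFE.symm.hasSymmSolutions hPAC.hasSymmSolutions).isSepClosed_residueField O hO
  refine ⟨hk, fun F₂ _ hF₂ => ⟨fun ψ => ?_⟩⟩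
  obtain ⟨S, hS⟩ := (hF₂.trans hFE).exists_isSepClosed_subfield ψ
  exact hsub S hS
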